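/- arXiv:2412.03506 — 7 statements merged into one kernel-verified Lean document; each statement's English description precedes it below -/
import Mathlib

section
/- The self-test loss function satisfies the identity 𝓔(φ) = ∑_{l=1}^L ⟨R_l(φ − φ*), v_l(φ − φ*)⟩ for every φ ∈ H, and consequently 𝓔(φ*) ≤ 𝓔(φ) for all φ ∈ H, i.e. the true parameter φ* is a minimizer of 𝓔. -/
open scoped BigOperators

/-- The self-test loss function `𝓔(φ) = ∑_l (⟨R_l φ, v_l φ⟩ − 2⟨f_l, v_l φ⟩) + C₀`
with `f_l = R_l φ*` and `C₀ = ∑_l ⟨R_l φ*, v_l φ*⟩`, where the dual pairing is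
`⟨y, ξ⟩ = ξ y`. -/
noncomputable def selfTestLoss {H Y : Type*} [AddCommGroup H] [Module ℝ H]
    [NormedAddCommGroup Y] [NormedSpace ℝ Y]
    (L : ℕ) (R : Fin L → H →ₗ[ℝ] Y) (v : Fin L → H →ₗ[ℝ] (Y →L[ℝ] ℝ))
    (φs φ : H) : ℝ :=
  (∑ l, (v l φ (R l φ) - 2 * v l φ (R l φs))) + ∑ l, v l φs (R l φs)

theorem selfTestLoss_eq_sum {H Y : Type*} [AddCommGroup H] [Module ℝ H]
    [NormedAddCommGroup Y] [NormedSpace ℝ Y]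
    (L : ℕ) (R : Fin L → H →ₗ[ℝ] Y) (v : Fin L → H →ₗ[ℝ] (Y →L[ℝ] ℝ))
    (hsymm : ∀ (l : Fin L) (φ ψ : H), v l ψ (R l φ) = v l φ (R l ψ)) (φs φ : H) :
    selfTestLoss L R v φs φ = ∑ l, v l (φ - φs) (R l (φ - φs)) := by
  rw [selfTestLoss, ← Finset.sum_add_distrib]
  refine Finset.sum_congr rfl fun l _ => ?_
  simp only [map_sub, sub_apply]
  linarith [hsymm l φ φs]

theorem stmt0 {H Y : Type*} [AddCommGroup H] [Module ℝ H]
    [NormedAddCommGroup Y] [NormedSpace ℝ Y]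
    (L : ℕ) (R : Fin L → H →ₗ[ℝ] Y) (v : Fin L → H →ₗ[ℝ] (Y →L[ℝ] ℝ))
    (hsymm : ∀ (l : Fin L) (φ ψ : H), v l ψ (R l φ) = v l φ (R l ψ))
    (hpos : ∀ (l : Fin L) (φ : H), 0 ≤ v l φ (R l φ))
    (φs : H) :
    (∀ φ : H, selfTestLoss L R v φs φ = ∑ l, v l (φ - φs) (R l (φ - φs))) ∧
    (∀ φ : H, selfTestLoss L R v φs φs ≤ selfTestLoss L R v φs φ) := by
  have key := selfTestLoss_eq_sum L R v hsymm φs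
  refine ⟨key, fun φ => ?_⟩
  rw [key, key]
  simpa using Finset.sum_nonneg fun l _ => hpos l (φ - φs)
end

section
/- The gradient-flow self-test loss satisfies, for every φ ∈ H, the identity 𝓔(φ) = ∫₀ᵀ Q_t(φ − φ*, φ − φ*) dt − ∫₀ᵀ Q_t(φ*, φ*) dt. -/
open MeasureTheory intervalIntegral

/-- The gradient-flow self-test loss
`𝓔(φ) = 2(e(φ,T) − e(φ,0)) + ∫₀ᵀ ⟨A_t(D_t φ), D_t φ⟩ dt`,
with dual pairing `⟨y, ξ⟩ = ξ y`, so `Q_t(φ,ψ) = (D_t ψ)(A_t (D_t φ))`. -/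
noncomputable def gfLoss {H Y : Type*} [AddCommGroup H] [Module ℝ H]
    [NormedAddCommGroup Y] [NormedSpace ℝ Y]
    (T : ℝ) (A : ℝ → (Y →L[ℝ] ℝ) →ₗ[ℝ] Y) (D : ℝ → H →ₗ[ℝ] (Y →L[ℝ] ℝ))
    (e : H → ℝ → ℝ) (φ : H) : ℝ :=
  2 * (e φ T - e φ 0) + ∫ t in (0:ℝ)..T, D t φ (A t (D t φ))

/-- The gradient-flow self-test loss satisfies
`𝓔(φ) = ∫₀ᵀ Q_t(φ − φ*, φ − φ*) dt − ∫₀ᵀ Q_t(φ*, φ*) dt` for every φ. -/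
theorem stmt4 {H Y : Type*} [AddCommGroup H] [Module ℝ H]
    [NormedAddCommGroup Y] [NormedSpace ℝ Y]
    (T : ℝ) (hT : 0 < T)
    (A : ℝ → (Y →L[ℝ] ℝ) →ₗ[ℝ] Y) (D : ℝ → H →ₗ[ℝ] (Y →L[ℝ] ℝ))
    (hAsymm : ∀ t ∈ Set.Icc (0:ℝ) T, ∀ ξ η : Y →L[ℝ] ℝ, η (A t ξ) = ξ (A t η))
    (hApos : ∀ t ∈ Set.Icc (0:ℝ) T, ∀ ξ : Y →L[ℝ] ℝ, 0 ≤ ξ (A t ξ))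
    (φs : H) (e : H → ℝ → ℝ)
    (helin : ∀ t : ℝ, IsLinearMap ℝ (fun φ => e φ t))
    (hderiv : ∀ φ : H, ∀ t ∈ Set.Icc (0:ℝ) T,
      HasDerivAt (e φ) (-(D t φ (A t (D t φs)))) t)
    (hcont : ∀ φ ψ : H, ContinuousOn (fun t => D t ψ (A t (D t φ))) (Set.Icc 0 T)) :
    ∀ φ : H, gfLoss T A D e φ =
      (∫ t in (0:ℝ)..T, D t (φ - φs) (A t (D t (φ - φs))))
        - ∫ t in (0:ℝ)..T, D t φs (A t (D t φs)) := by
  intro φ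
  have hint : ∀ φ ψ : H,
      IntervalIntegrable (fun t => D t ψ (A t (D t φ))) volume 0 T := fun φ ψ =>
    ContinuousOn.intervalIntegrable (by simpa only [Set.uIcc_of_le hT.le] using hcont φ ψ)
  have hftc : ∫ t in (0:ℝ)..T, -(D t φ (A t (D t φs))) = e φ T - e φ 0 :=
    integral_eq_sub_of_hasDerivAt
      (fun t ht => hderiv φ t (by rwa [Set.uIcc_of_le hT.le] at ht)) (hint φs φ).neg
  have hexpand : ∫ t in (0:ℝ)..T, D t (φ - φs) (A t (D t (φ - φs))) =
      ∫ t in (0:ℝ)..T, (D t φ (A t (D t φ)) - 2 * D t φ (A t (D t φs))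
        + D t φs (A t (D t φs))) := by
    refine integral_congr fun t ht => ?_
    rw [Set.uIcc_of_le hT.le] at ht
    have hsymm := hAsymm t ht (D t φ) (D t φs)
    simp only [map_sub, sub_apply]
    linarith
  rw [intervalIntegral.integral_neg] at hftc
  rw [gfLoss, hexpand,
    intervalIntegral.integral_add ((hint φ φ).sub ((hint φs φ).const_mul 2)) (hint φs φs),
    intervalIntegral.integral_sub (hint φ φ) ((hint φs φ).const_mul 2),
    intervalIntegral.integral_const_mul]
  linarith
end

section
/- The true parameter φ* is a minimizer of the gradient-flow self-test loss: 𝓔(φ*) ≤ 𝓔(φ) for all φ ∈ H, and its minimum value is 𝓔(φ*) = −∫₀ᵀ Q_t(φ*, φ*) dt ≤ 0. -/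
open MeasureTheory intervalIntegral

/-- The loss equals the integrated dissipation of the error `φ - φs`, up to a constant. -/
theorem gfLoss_eq_integral {H Y : Type*} [AddCommGroup H] [Module ℝ H]
    [NormedAddCommGroup Y] [NormedSpace ℝ Y]
    {T : ℝ} (hT : 0 ≤ T)
    {A : ℝ → (Y →L[ℝ] ℝ) →ₗ[ℝ] Y} {D : ℝ → H →ₗ[ℝ] (Y →L[ℝ] ℝ)}
    (hAsymm : ∀ t ∈ Set.Icc (0:ℝ) T, ∀ ξ η : Y →L[ℝ] ℝ, η (A t ξ) = ξ (A t η))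
    {φs : H} {e : H → ℝ → ℝ}
    (hderiv : ∀ φ : H, ∀ t ∈ Set.Icc (0:ℝ) T,
      HasDerivAt (e φ) (-(D t φ (A t (D t φs)))) t)
    (hcont : ∀ φ ψ : H, ContinuousOn (fun t => D t ψ (A t (D t φ))) (Set.Icc 0 T)) (φ : H) :
    gfLoss T A D e φ = (∫ t in (0:ℝ)..T, D t (φ - φs) (A t (D t (φ - φs)))) -
      ∫ t in (0:ℝ)..T, D t φs (A t (D t φs)) := by
  have hint (φ ψ : H) :
      IntervalIntegrable (fun t => D t ψ (A t (D t φ))) volume 0 T :=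
    (hcont φ ψ).intervalIntegrable_of_Icc hT
  have hftc : ∫ t in (0:ℝ)..T, -(D t φ (A t (D t φs))) = e φ T - e φ 0 :=
    integral_eq_sub_of_hasDerivAt
      (fun t ht => hderiv φ t (by rwa [Set.uIcc_of_le hT] at ht)) (hint φs φ).neg
  rw [gfLoss, ← hftc, intervalIntegral.integral_neg, mul_neg, neg_add_eq_sub,
    ← intervalIntegral.integral_const_mul,
    ← intervalIntegral.integral_sub (hint φ φ) ((hint φs φ).const_mul 2),
    ← intervalIntegral.integral_sub (hint _ _) (hint _ _)]
  refine intervalIntegral.integral_congr fun t ht => ?_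
  rw [Set.uIcc_of_le hT] at ht
  have hsymm := hAsymm t ht (D t φ) (D t φs)
  simp only [map_sub, sub_apply]
  linarith

/-- The true parameter φ* is a minimizer of the gradient-flow self-test loss,
with minimum value `𝓔(φ*) = −∫₀ᵀ Q_t(φ*,φ*) dt ≤ 0`. -/
theorem stmt5 {H Y : Type*} [AddCommGroup H] [Module ℝ H]
    [NormedAddCommGroup Y] [NormedSpace ℝ Y]
    (T : ℝ) (hT : 0 < T)
    (A : ℝ → (Y →L[ℝ] ℝ) →ₗ[ℝ] Y) (D : ℝ → H →ₗ[ℝ] (Y →L[ℝ] ℝ))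
    (hAsymm : ∀ t ∈ Set.Icc (0:ℝ) T, ∀ ξ η : Y →L[ℝ] ℝ, η (A t ξ) = ξ (A t η))
    (hApos : ∀ t ∈ Set.Icc (0:ℝ) T, ∀ ξ : Y →L[ℝ] ℝ, 0 ≤ ξ (A t ξ))
    (φs : H) (e : H → ℝ → ℝ)
    (helin : ∀ t : ℝ, IsLinearMap ℝ (fun φ => e φ t))
    (hderiv : ∀ φ : H, ∀ t ∈ Set.Icc (0:ℝ) T,
      HasDerivAt (e φ) (-(D t φ (A t (D t φs)))) t)
    (hcont : ∀ φ ψ : H, ContinuousOn (fun t => D t ψ (A t (D t φ))) (Set.Icc 0 T)) :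
    (∀ φ : H, gfLoss T A D e φs ≤ gfLoss T A D e φ) ∧
    gfLoss T A D e φs = -∫ t in (0:ℝ)..T, D t φs (A t (D t φs)) ∧
    gfLoss T A D e φs ≤ 0 := by
  have hloss := gfLoss_eq_integral hT.le hAsymm hderiv hcont
  have hnonneg (ψ : H) : 0 ≤ ∫ t in (0:ℝ)..T, D t ψ (A t (D t ψ)) :=
    intervalIntegral.integral_nonneg hT.le fun t ht => hApos t ht _
  have hmin : gfLoss T A D e φs = -∫ t in (0:ℝ)..T, D t φs (A t (D t φs)) := by
    simp [hloss φs]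
  refine ⟨fun φ => ?_, hmin, ?_⟩
  · rw [hmin, hloss φ]
    linarith [hnonneg (φ - φs)]
  · rw [hmin]
    linarith [hnonneg φs]
end

section
/- Let 𝓗 be a linear subspace of H containing φ*. If ∫₀ᵀ Q_t(φ, φ) dt > 0 for every nonzero φ ∈ 𝓗, then φ* is the unique minimizer of the gradient-flow self-test loss 𝓔 over 𝓗. -/
open MeasureTheory intervalIntegral

/-- Along the gradient flow, the excess loss over the true parameter is the dissipation
`∫₀ᵀ Q_t(φ − φ*, φ − φ*) dt`. -/
theorem gfLoss_eq_add_integral {H Y : Type*} [AddCommGroup H] [Module ℝ H]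
    [NormedAddCommGroup Y] [NormedSpace ℝ Y]
    {T : ℝ} (hT : 0 ≤ T)
    {A : ℝ → (Y →L[ℝ] ℝ) →ₗ[ℝ] Y} {D : ℝ → H →ₗ[ℝ] (Y →L[ℝ] ℝ)}
    (hAsymm : ∀ t ∈ Set.Icc (0:ℝ) T, ∀ ξ η : Y →L[ℝ] ℝ, η (A t ξ) = ξ (A t η))
    {φs : H} {e : H → ℝ → ℝ}
    (hderiv : ∀ φ : H, ∀ t ∈ Set.Icc (0:ℝ) T,
      HasDerivAt (e φ) (-(D t φ (A t (D t φs)))) t)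
    (hcont : ∀ φ ψ : H, ContinuousOn (fun t => D t ψ (A t (D t φ))) (Set.Icc 0 T)) (φ : H) :
    gfLoss T A D e φ =
      gfLoss T A D e φs + ∫ t in (0:ℝ)..T, D t (φ - φs) (A t (D t (φ - φs))) := by
  have hQint (φ ψ : H) :
      IntervalIntegrable (fun t => D t ψ (A t (D t φ))) volume 0 T :=
    ContinuousOn.intervalIntegrable_of_Icc hT (hcont φ ψ)
  have hftc (ψ : H) : e ψ T - e ψ 0 = -∫ t in (0:ℝ)..T, D t ψ (A t (D t φs)) := by
    rw [← intervalIntegral.integral_neg]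
    refine (integral_eq_sub_of_hasDerivAt (fun t ht => hderiv ψ t ?_) (hQint φs ψ).neg).symm
    rwa [Set.uIcc_of_le hT] at ht
  have hexpand : ∫ t in (0:ℝ)..T, D t (φ - φs) (A t (D t (φ - φs))) =
      ∫ t in (0:ℝ)..T, (D t φ (A t (D t φ)) - 2 * D t φ (A t (D t φs))
        + D t φs (A t (D t φs))) := by
    refine integral_congr fun t ht => ?_
    rw [Set.uIcc_of_le hT] at ht
    have hsymm := hAsymm t ht (D t φ) (D t φs)
    simp only [map_sub, sub_apply]
    linarith
  rw [hexpand, intervalIntegral.integral_add ((hQint φ φ).sub ((hQint φs φ).const_mul 2))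
      (hQint φs φs), intervalIntegral.integral_sub (hQint φ φ) ((hQint φs φ).const_mul 2),
    intervalIntegral.integral_const_mul]
  simp only [gfLoss, hftc]
  ring

/-- If `∫₀ᵀ Q_t(φ,φ) dt > 0` for every nonzero φ in a linear subspace 𝓗 ∋ φ*,
then φ* is the unique minimizer of the gradient-flow self-test loss over 𝓗. -/
theorem stmt6 {H Y : Type*} [AddCommGroup H] [Module ℝ H]
    [NormedAddCommGroup Y] [NormedSpace ℝ Y]
    (T : ℝ) (hT : 0 < T)
    (A : ℝ → (Y →L[ℝ] ℝ) →ₗ[ℝ] Y) (D : ℝ → H →ₗ[ℝ] (Y →L[ℝ] ℝ))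
    (hAsymm : ∀ t ∈ Set.Icc (0:ℝ) T, ∀ ξ η : Y →L[ℝ] ℝ, η (A t ξ) = ξ (A t η))
    (hApos : ∀ t ∈ Set.Icc (0:ℝ) T, ∀ ξ : Y →L[ℝ] ℝ, 0 ≤ ξ (A t ξ))
    (φs : H) (e : H → ℝ → ℝ)
    (helin : ∀ t : ℝ, IsLinearMap ℝ (fun φ => e φ t))
    (hderiv : ∀ φ : H, ∀ t ∈ Set.Icc (0:ℝ) T,
      HasDerivAt (e φ) (-(D t φ (A t (D t φs)))) t)
    (hcont : ∀ φ ψ : H, ContinuousOn (fun t => D t ψ (A t (D t φ))) (Set.Icc 0 T))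
    (𝓗 : Submodule ℝ H) (hφs : φs ∈ 𝓗)
    (hQpos : ∀ φ ∈ 𝓗, φ ≠ 0 → 0 < ∫ t in (0:ℝ)..T, D t φ (A t (D t φ))) :
    (∀ φ ∈ 𝓗, gfLoss T A D e φs ≤ gfLoss T A D e φ) ∧
    (∀ φ ∈ 𝓗, gfLoss T A D e φ = gfLoss T A D e φs → φ = φs) := by
  have hexcess := gfLoss_eq_add_integral hT.le hAsymm hderiv hcont
  refine ⟨fun φ _ => ?_, fun φ hφ heq => ?_⟩
  · rw [hexcess φ, le_add_iff_nonneg_right]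
    exact integral_nonneg hT.le fun t ht => hApos t ht _
  · by_contra hne
    have hpos := hQpos (φ - φs) (𝓗.sub_mem hφ hφs) (sub_ne_zero.mpr hne)
    linarith [hexcess φ]
end

section
/- Energy conservation: every minimizer φ₀ of the gradient-flow self-test loss 𝓔 over H satisfies e(φ₀, T) − e(φ₀, 0) = −∫₀ᵀ Q_t(φ₀, φ₀) dt; that is, the energy change of the estimated free energy along the data flow equals the total energy dissipation. -/
open MeasureTheory intervalIntegral

/-- Energy conservation: every minimizer φ₀ of the gradient-flow self-test loss
satisfies `e(φ₀,T) − e(φ₀,0) = −∫₀ᵀ Q_t(φ₀,φ₀) dt`. -/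
theorem stmt7 {H Y : Type*} [AddCommGroup H] [Module ℝ H]
    [NormedAddCommGroup Y] [NormedSpace ℝ Y]
    (T : ℝ) (hT : 0 < T)
    (A : ℝ → (Y →L[ℝ] ℝ) →ₗ[ℝ] Y) (D : ℝ → H →ₗ[ℝ] (Y →L[ℝ] ℝ))
    (hAsymm : ∀ t ∈ Set.Icc (0:ℝ) T, ∀ ξ η : Y →L[ℝ] ℝ, η (A t ξ) = ξ (A t η))
    (hApos : ∀ t ∈ Set.Icc (0:ℝ) T, ∀ ξ : Y →L[ℝ] ℝ, 0 ≤ ξ (A t ξ))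
    (φs : H) (e : H → ℝ → ℝ)
    (helin : ∀ t : ℝ, IsLinearMap ℝ (fun φ => e φ t))
    (hderiv : ∀ φ : H, ∀ t ∈ Set.Icc (0:ℝ) T,
      HasDerivAt (e φ) (-(D t φ (A t (D t φs)))) t)
    (hcont : ∀ φ ψ : H, ContinuousOn (fun t => D t ψ (A t (D t φ))) (Set.Icc 0 T))
    (φ₀ : H) (hmin : ∀ φ : H, gfLoss T A D e φ₀ ≤ gfLoss T A D e φ) :
    e φ₀ T - e φ₀ 0 = -∫ t in (0:ℝ)..T, D t φ₀ (A t (D t φ₀)) := by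
  set a := e φ₀ T - e φ₀ 0 with ha
  set q := ∫ t in (0:ℝ)..T, D t φ₀ (A t (D t φ₀)) with hq
  have hscale (s : ℝ) : gfLoss T A D e (s • φ₀) = 2 * (s * a) + s ^ 2 * q := by
    have he (t : ℝ) : e (s • φ₀) t = s * e φ₀ t := (helin t).map_smul s φ₀
    have hQ (t : ℝ) : D t (s • φ₀) (A t (D t (s • φ₀))) =
        s ^ 2 * D t φ₀ (A t (D t φ₀)) := by
      simp only [map_smul, smul_apply, smul_eq_mul]
      ring
    simp only [gfLoss, he, hQ, intervalIntegral.integral_const_mul, ha, hq]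
    ring
  have hquad (h : ℝ) : 0 ≤ q * (h * h) + 2 * (a + q) * h + 0 := by
    have h₁ := hscale 1
    rw [one_smul] at h₁
    have h₂ := hmin ((1 + h) • φ₀)
    rw [hscale, h₁] at h₂
    linarith
  have hdisc := discrim_le_zero hquad
  rw [discrim] at hdisc
  have hzero : a + q = 0 := pow_eq_zero_iff two_ne_zero |>.mp
    (le_antisymm (by linarith) (sq_nonneg (a + q)))
  linarith
end

section
/- For every continuously differentiable V : ℝ^d → ℝ with ∫ V ρ dx = 0 and ∫ (V² + |∇V|²) ρ dx < ∞, the quadratic functional satisfies the coercivity bound ∫ |∇V|² ρ dx − 2 ∫ ⟨∇V, w⟩ ρ dx ≥ (1/(2(1+c))) ∫ (V² + |∇V|²) ρ dx − 2(1+c) ∫ |w|² ρ dx. In particular the self-test loss for estimating the kinetic potential V is coercive and uniformly convex on the mean-zero weighted Sobolev class. -/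
open MeasureTheory
open scoped RealInnerProductSpace

/-- Coercivity of the self-test loss for the kinetic potential V: if ρ satisfies
a Poincaré inequality with constant c on mean-zero functions, then for every such
C¹ function V with finite weighted H¹ norm,
`∫|∇V|²ρ − 2∫⟨∇V,w⟩ρ ≥ (1/(2(1+c))) ∫(V² + |∇V|²)ρ − 2(1+c) ∫|w|²ρ`. -/
theorem stmt11 (d : ℕ) (ρ : EuclideanSpace ℝ (Fin d) → ℝ)
    (hρ_meas : Measurable ρ) (hρ_nonneg : ∀ x, 0 ≤ ρ x)
    (c : ℝ) (hc : 0 < c)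
    (hPoincare : ∀ g : EuclideanSpace ℝ (Fin d) → ℝ, ContDiff ℝ 1 g →
      (∫ x, g x * ρ x) = 0 →
      Integrable (fun x => ((g x) ^ 2 + ‖gradient g x‖ ^ 2) * ρ x) →
      ∫ x, (g x) ^ 2 * ρ x ≤ c * ∫ x, ‖gradient g x‖ ^ 2 * ρ x)
    (w : EuclideanSpace ℝ (Fin d) → EuclideanSpace ℝ (Fin d))
    (hw_meas : Measurable w)
    (hw_int : Integrable (fun x => ‖w x‖ ^ 2 * ρ x)) :
    ∀ V : EuclideanSpace ℝ (Fin d) → ℝ, ContDiff ℝ 1 V →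
      (∫ x, V x * ρ x) = 0 →
      Integrable (fun x => ((V x) ^ 2 + ‖gradient V x‖ ^ 2) * ρ x) →
      (1 / (2 * (1 + c))) * (∫ x, ((V x) ^ 2 + ‖gradient V x‖ ^ 2) * ρ x)
          - 2 * (1 + c) * ∫ x, ‖w x‖ ^ 2 * ρ x
        ≤ (∫ x, ‖gradient V x‖ ^ 2 * ρ x)
          - 2 * ∫ x, ⟪gradient V x, w x⟫ * ρ x := by
  intro V hV hmean hint
  have hgrad : Continuous (gradient V) :=
    (InnerProductSpace.toDual ℝ (EuclideanSpace ℝ (Fin d))).symm.continuous.comp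
      (hV.continuous_fderiv one_ne_zero)
  have hV_int : Integrable (fun x => (V x) ^ 2 * ρ x) := by
    refine hint.mono' ((hV.continuous.measurable.pow_const 2).mul hρ_meas).aestronglyMeasurable
      (.of_forall fun x => ?_)
    rw [Real.norm_of_nonneg (mul_nonneg (sq_nonneg _) (hρ_nonneg x))]
    exact mul_le_mul_of_nonneg_right (le_add_of_nonneg_right (sq_nonneg _)) (hρ_nonneg x)
  have hgrad_int : Integrable (fun x => ‖gradient V x‖ ^ 2 * ρ x) := by
    refine (hint.sub hV_int).congr (.of_forall fun x => ?_)
    simp only [Pi.sub_apply]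
    ring
  have hsum : ∫ x, ((V x) ^ 2 + ‖gradient V x‖ ^ 2) * ρ x
      = (∫ x, (V x) ^ 2 * ρ x) + ∫ x, ‖gradient V x‖ ^ 2 * ρ x := by
    rw [← integral_add hV_int hgrad_int]
    simp only [add_mul]
  have hyoung (x) : |⟪gradient V x, w x⟫ * ρ x|
      ≤ 1 / 4 * (‖gradient V x‖ ^ 2 * ρ x) + ‖w x‖ ^ 2 * ρ x := by
    rw [abs_mul, abs_of_nonneg (hρ_nonneg x), ← mul_assoc, ← add_mul]
    refine mul_le_mul_of_nonneg_right ?_ (hρ_nonneg x)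
    refine (abs_real_inner_le_norm _ _).trans ?_
    nlinarith [sq_nonneg (‖gradient V x‖ / 2 - ‖w x‖)]
  have hbound_int := (hgrad_int.const_mul (1 / 4)).add hw_int
  have hinner_int : Integrable (fun x => ⟪gradient V x, w x⟫ * ρ x) :=
    hbound_int.mono' ((hgrad.measurable.inner hw_meas).mul hρ_meas).aestronglyMeasurable
      (.of_forall hyoung)
  have hinner : ∫ x, ⟪gradient V x, w x⟫ * ρ x
      ≤ 1 / 4 * (∫ x, ‖gradient V x‖ ^ 2 * ρ x) + ∫ x, ‖w x‖ ^ 2 * ρ x := by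
    rw [← integral_const_mul, ← integral_add (hgrad_int.const_mul _) hw_int]
    exact integral_mono hinner_int hbound_int fun x => (le_abs_self _).trans (hyoung x)
  have hw_nonneg : 0 ≤ ∫ x, ‖w x‖ ^ 2 * ρ x :=
    integral_nonneg fun x => mul_nonneg (sq_nonneg _) (hρ_nonneg x)
  have hnorm : 1 / (2 * (1 + c)) * (∫ x, ((V x) ^ 2 + ‖gradient V x‖ ^ 2) * ρ x)
      ≤ 1 / 2 * ∫ x, ‖gradient V x‖ ^ 2 * ρ x := by
    rw [hsum, div_mul_eq_mul_div, div_le_iff₀ (by positivity)]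
    linarith [hPoincare V hV hmean hint]
  linarith [mul_nonneg hc.le hw_nonneg]
end

section
/- Let u : ℝ^d → [0, ∞) be a bounded measurable function with compact support and let v : ℝ^d → ℝ^d be integrable. Then ∫_{ℝ^d} u(x) ‖(v ∗ u)(x)‖² dx = ∫_{ℝ^d} ∫_{ℝ^d} ⟨v(y), v(y')⟩ G(y, y') dy dy', where (v ∗ u)(x) := ∫_{ℝ^d} v(y) u(x − y) dy (componentwise convolution) and G(y, y') := ∫_{ℝ^d} u(x) u(x − y) u(x − y') dx. -/
open MeasureTheory
open scoped RealInnerProductSpace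

/-- The inner product of two integrable functions of separate variables is integrable on the
product space. -/
theorem MeasureTheory.Integrable.inner_prod {α β E : Type*} [MeasurableSpace α]
    [MeasurableSpace β] [NormedAddCommGroup E] [InnerProductSpace ℝ E]
    {μ : Measure α} {ν : Measure β} [SFinite μ] [SFinite ν] {f : α → E} {g : β → E}
    (hf : Integrable f μ) (hg : Integrable g ν) :
    Integrable (fun p : α × β => ⟪f p.1, g p.2⟫) (μ.prod ν) := by
  refine (hf.norm.mul_prod hg.norm).mono
    (hf.aestronglyMeasurable.comp_fst.inner hg.aestronglyMeasurable.comp_snd) ?_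
  filter_upwards with p
  simpa using norm_inner_le_norm (𝕜 := ℝ) (f p.1) (g p.2)

/-- The squared norm of an integral is the double integral of the inner products. -/
theorem MeasureTheory.norm_integral_sq_eq_integral_inner {α E : Type*} [MeasurableSpace α]
    [NormedAddCommGroup E] [InnerProductSpace ℝ E] [CompleteSpace E]
    {μ : Measure α} [SFinite μ] {f : α → E} (hf : Integrable f μ) :
    ‖∫ y, f y ∂μ‖ ^ 2 = ∫ p, ⟪f p.1, f p.2⟫ ∂(μ.prod μ) := by
  rw [integral_prod _ (hf.inner_prod hf), ← real_inner_self_eq_norm_sq,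
    ← integral_inner hf]
  refine integral_congr_ae (.of_forall fun y => ?_)
  simp only
  rw [integral_inner hf, real_inner_comm]

/-- For u bounded measurable nonnegative with compact support and v integrable,
`∫ u(x) ‖(v ∗ u)(x)‖² dx = ∫∫ ⟨v(y), v(y')⟩ G(y,y') dy dy'` where
`(v ∗ u)(x) = ∫ v(y) u(x − y) dy` and `G(y,y') = ∫ u(x) u(x−y) u(x−y') dx`. -/
theorem stmt12 (d : ℕ) (u : EuclideanSpace ℝ (Fin d) → ℝ)
    (hu_meas : Measurable u) (hu_nonneg : ∀ x, 0 ≤ u x)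
    (hu_bdd : ∃ C : ℝ, ∀ x, u x ≤ C) (hu_supp : HasCompactSupport u)
    (v : EuclideanSpace ℝ (Fin d) → EuclideanSpace ℝ (Fin d))
    (hv : Integrable v) :
    ∫ x, u x * ‖∫ y, u (x - y) • v y‖ ^ 2
      = ∫ y, ∫ y', ⟪v y, v y'⟫ * ∫ x, u x * (u (x - y) * u (x - y')) := by
  obtain ⟨C, hC⟩ := hu_bdd
  have hu_norm (x) : ‖u x‖ ≤ C := by
    rw [Real.norm_of_nonneg (hu_nonneg x)]
    exact hC x
  have hC0 : 0 ≤ C := (hu_nonneg 0).trans (hC 0)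
  have hu_int : Integrable u := by
    rw [← integrableOn_iff_integrable_of_support_subset (subset_tsupport u)]
    exact Measure.integrableOn_of_bounded hu_supp.isCompact.measure_lt_top.ne
      hu_meas.aestronglyMeasurable (.of_forall hu_norm)
  have hw (x) : Integrable (fun y => u (x - y) • v y) :=
    hv.bdd_smul C (hu_meas.comp (by fun_prop)).aestronglyMeasurable (.of_forall fun y => hu_norm _)
  let F := fun (x : EuclideanSpace ℝ (Fin d))
    (p : EuclideanSpace ℝ (Fin d) × EuclideanSpace ℝ (Fin d)) =>
    (u (x - p.1) * u (x - p.2)) * (u x * ⟪v p.1, v p.2⟫)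
  have hF : Integrable (Function.uncurry F) (volume.prod (volume.prod volume)) := by
    refine (hu_int.mul_prod (hv.inner_prod hv)).bdd_mul (c := C * C)
      (f := fun q => u (q.1 - q.2.1) * u (q.1 - q.2.2)) (by fun_prop) (.of_forall fun q => ?_)
    rw [norm_mul]
    exact mul_le_mul (hu_norm _) (hu_norm _) (norm_nonneg _) hC0
  calc ∫ x, u x * ‖∫ y, u (x - y) • v y‖ ^ 2
      = ∫ x, ∫ p, F x p ∂(volume.prod volume) := by
        refine integral_congr_ae (.of_forall fun x => ?_)
        simp only
        rw [norm_integral_sq_eq_integral_inner (hw x), ← integral_const_mul]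
        refine integral_congr_ae (.of_forall fun p => ?_)
        simp only [F, real_inner_smul_left, real_inner_smul_right]
        ring
    _ = ∫ p, (∫ x, F x p) ∂(volume.prod volume) := integral_integral_swap hF
    _ = ∫ y, ∫ y', ∫ x, F x (y, y') := integral_prod _ hF.integral_prod_right
    _ = _ := by
        simp only [← integral_const_mul]
        congr! 6
        simp only [F]
        ring
end
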